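/- Let ζ = exp(2πi/3) and let X and Y be the 4×4 complex matrices X = [[ζ²−ζ, ζ²+ζ−1, ζ²−1, ζ], [3ζ²−3, −ζ²+3ζ−2, 3ζ−2, −ζ²+ζ+1], [6ζ²−5, 4ζ−4, ζ²+5ζ−6, −3ζ²+3ζ+1], [−ζ²+6ζ−5, −5ζ²+4ζ+1, −6ζ²+5ζ+1, −2ζ²−2ζ+3]] and Y = [[ζ²−ζ, ζ², ζ²−1, ζ], [ζ²−ζ+1, 2ζ²−ζ−1, ζ²−1, ζ], [ζ²−2ζ+1, 2ζ²−ζ−1, 2ζ²−ζ, ζ²+ζ−1], [ζ²−1, ζ−1, ζ−1, −ζ²]]. Then X and Y have no common invariant subspace of dimension 1 and no common invariant subspace of dimension 2: if V ⊆ ℂ⁴ is a complex subspace with X·V ⊆ V and Y·V ⊆ V, then dim_ℂ V ∉ {1, 2}. -/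

import Mathlib

/-- `ζ = exp(2πi/3)`, a primitive third root of unity. -/
noncomputable def ζ : ℂ := Complex.exp (2 * Real.pi * Complex.I / 3)

/-- The monodromy matrix `X` along the loop `ρ₁`. -/
noncomputable def matX : Matrix (Fin 4) (Fin 4) ℂ :=
  !![ζ^2 - ζ,          ζ^2 + ζ - 1,      ζ^2 - 1,          ζ;
     3*ζ^2 - 3,        -ζ^2 + 3*ζ - 2,   3*ζ - 2,          -ζ^2 + ζ + 1;
     6*ζ^2 - 5,        4*ζ - 4,          ζ^2 + 5*ζ - 6,    -3*ζ^2 + 3*ζ + 1;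
     -ζ^2 + 6*ζ - 5,   -5*ζ^2 + 4*ζ + 1, -6*ζ^2 + 5*ζ + 1, -2*ζ^2 - 2*ζ + 3]

/-- The monodromy matrix `Y` along the loop `ρ₂`. -/
noncomputable def matY : Matrix (Fin 4) (Fin 4) ℂ :=
  !![ζ^2 - ζ,       ζ^2,           ζ^2 - 1,     ζ;
     ζ^2 - ζ + 1,   2*ζ^2 - ζ - 1, ζ^2 - 1,     ζ;
     ζ^2 - 2*ζ + 1, 2*ζ^2 - ζ - 1, 2*ζ^2 - ζ,   ζ^2 + ζ - 1;
     ζ^2 - 1,       ζ - 1,         ζ - 1,       -ζ^2]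

theorem zeta_eq : ζ ^ 2 + ζ + 1 = 0 := by
  have hp : IsPrimitiveRoot ζ 3 := by
    have := Complex.isPrimitiveRoot_exp 3 (by norm_num)
    simpa [ζ] using this
  have h3 : ζ ^ 3 = 1 := hp.pow_eq_one
  have h1 : ζ ≠ 1 := hp.ne_one (by norm_num)
  have : (ζ - 1) * (ζ ^ 2 + ζ + 1) = 0 := by linear_combination h3
  exact (mul_eq_zero.mp this).resolve_left (sub_ne_zero.mpr h1)

theorem ext4 {v w : Fin 4 → ℂ} (h0 : v 0 = w 0) (h1 : v 1 = w 1) (h2 : v 2 = w 2)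
    (h3 : v 3 = w 3) : v = w := by
  funext i; fin_cases i <;> assumption

theorem ext16 {A B : Matrix (Fin 4) (Fin 4) ℂ}
    (h00 : A 0 0 = B 0 0) (h01 : A 0 1 = B 0 1) (h02 : A 0 2 = B 0 2) (h03 : A 0 3 = B 0 3)
    (h10 : A 1 0 = B 1 0) (h11 : A 1 1 = B 1 1) (h12 : A 1 2 = B 1 2) (h13 : A 1 3 = B 1 3)
    (h20 : A 2 0 = B 2 0) (h21 : A 2 1 = B 2 1) (h22 : A 2 2 = B 2 2) (h23 : A 2 3 = B 2 3)
    (h30 : A 3 0 = B 3 0) (h31 : A 3 1 = B 3 1) (h32 : A 3 2 = B 3 2) (h33 : A 3 3 = B 3 3) :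
    A = B := by
  ext i j; fin_cases i <;> fin_cases j <;> assumption

theorem mem_of_smul (V : Submodule ℂ (Fin 4 → ℂ)) {u w : Fin 4 → ℂ} (d : ℂ) (hd : d ≠ 0)
    (h : w = d • u) (hw : w ∈ V) : u ∈ V := by
  rw [h] at hw
  exact (V.smul_mem_iff hd).mp hw

theorem zero_of_mul {x : ℂ} (d : ℂ) (hd : d ≠ 0) (h : d * x = 0) : x = 0 :=
  (mul_eq_zero.mp h).resolve_left hd

theorem top_of (V : Submodule ℂ (Fin 4 → ℂ))
    (e0 : Pi.single 0 (1 : ℂ) ∈ V) (e1 : Pi.single 1 (1 : ℂ) ∈ V)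
    (e2 : Pi.single 2 (1 : ℂ) ∈ V) (e3 : Pi.single 3 (1 : ℂ) ∈ V) : V = ⊤ := by
  rw [eq_top_iff]
  intro v _
  have hv : v = v 0 • (Pi.single 0 (1 : ℂ) : Fin 4 → ℂ) + v 1 • (Pi.single 1 (1 : ℂ) : Fin 4 → ℂ)
      + v 2 • (Pi.single 2 (1 : ℂ) : Fin 4 → ℂ) + v 3 • (Pi.single 3 (1 : ℂ) : Fin 4 → ℂ) := by
    apply ext4 <;> simp
  rw [hv]
  exact V.add_mem (V.add_mem (V.add_mem (V.smul_mem _ e0) (V.smul_mem _ e1)) (V.smul_mem _ e2))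
    (V.smul_mem _ e3)

/-- `V` is invariant under `M`. -/
def Stab (V : Submodule ℂ (Fin 4 → ℂ)) (M : Matrix (Fin 4) (Fin 4) ℂ) : Prop :=
  ∀ v ∈ V, M.mulVec v ∈ V

theorem stab_one (V : Submodule ℂ (Fin 4 → ℂ)) : Stab V 1 := by
  intro v hv; simpa using hv

theorem stab_mul (V : Submodule ℂ (Fin 4 → ℂ)) {A B : Matrix (Fin 4) (Fin 4) ℂ}
    (hA : Stab V A) (hB : Stab V B) : Stab V (A * B) := by
  intro v hv
  rw [← Matrix.mulVec_mulVec]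
  exact hA _ (hB _ hv)

theorem stab_add (V : Submodule ℂ (Fin 4 → ℂ)) {A B : Matrix (Fin 4) (Fin 4) ℂ}
    (hA : Stab V A) (hB : Stab V B) : Stab V (A + B) := by
  intro v hv
  rw [Matrix.add_mulVec]
  exact V.add_mem (hA _ hv) (hB _ hv)

theorem stab_smul (V : Submodule ℂ (Fin 4 → ℂ)) {A : Matrix (Fin 4) (Fin 4) ℂ} (c : ℂ)
    (hA : Stab V A) : Stab V (c • A) := by
  intro v hv
  rw [Matrix.smul_mulVec]
  exact V.smul_mem _ (hA _ hv)

noncomputable def W1 (z : ℂ) : Matrix (Fin 4) (Fin 4) ℂ :=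
  !![1, 0, 0, 0;
    0, 1, 0, 0;
    0, 0, 1, 0;
    0, 0, 0, 1]

noncomputable def WX (z : ℂ) : Matrix (Fin 4) (Fin 4) ℂ :=
  !![-1 + -2*z, -2, -2 + -1*z, 1*z;
    -6 + -3*z, -1 + 4*z, -2 + 3*z, 2 + 2*z;
    -11 + -6*z, -4 + 4*z, -7 + 4*z, 4 + 6*z;
    -4 + 7*z, 6 + 9*z, 7 + 11*z, 5]

noncomputable def WY (z : ℂ) : Matrix (Fin 4) (Fin 4) ℂ :=
  !![-1 + -2*z, -1 + -1*z, -2 + -1*z, 1*z;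
    -2*z, -3 + -3*z, -2 + -1*z, 1*z;
    -3*z, -3 + -3*z, -2 + -3*z, -2;
    -2 + -1*z, -1 + 1*z, -1 + 1*z, 1 + 1*z]

noncomputable def WXX (z : ℂ) : Matrix (Fin 4) (Fin 4) ℂ :=
  !![18 + 12*z, 7 + -7*z, 11 + -4*z, -4 + -8*z;
    36 + -11*z, -13 + -38*z, -7 + -41*z, -23 + -13*z;
    78, -8 + -66*z, 7 + -67*z, -42 + -33*z;
    -22 + -92*z, -76 + -50*z, -82 + -68*z, -26 + 21*z]

noncomputable def WYX (z : ℂ) : Matrix (Fin 4) (Fin 4) ℂ :=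
  !![9 + 12*z, 10 + 2*z, 12 + 4*z, -6*z;
    14 + 22*z, 18 + 4*z, 20 + 7*z, -9*z;
    15 + 28*z, 23 + 7*z, 24 + 12*z, 3 + -9*z;
    15, -2 + -13*z, 1 + -13*z, -8 + -6*z]

noncomputable def WXY (z : ℂ) : Matrix (Fin 4) (Fin 4) ℂ :=
  !![-5 + 6*z, 7 + 11*z, 4 + 8*z, 5 + 1*z;
    15 + 30*z, 29 + 13*z, 24 + 13*z, 3 + -12*z;
    17 + 55*z, 52 + 36*z, 44 + 34*z, 14 + -17*z;
    59 + 28*z, 27 + -30*z, 26 + -23*z, -25 + -31*z]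

noncomputable def WYY (z : ℂ) : Matrix (Fin 4) (Fin 4) ℂ :=
  !![-7 + 2*z, 1 + 8*z, 1 + 8*z, 6 + 3*z;
    -12, 13*z, 1 + 11*z, 8 + 4*z;
    -17 + -4*z, -4 + 13*z, -3 + 10*z, 8 + 7*z;
    4 + 11*z, 11 + 7*z, 9 + 6*z, 2 + -4*z]

noncomputable def WXXX (z : ℂ) : Matrix (Fin 4) (Fin 4) ℂ :=
  !![-130 + -10*z, 5 + 103*z, -18 + 102*z, 64 + 54*z;
    -80 + 299*z, 264 + 292*z, 252 + 348*z, 164 + -4*z;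
    -308 + 428*z, 401 + 583*z, 346 + 663*z, 336 + 73*z;
    595 + 749*z, 575 + 49*z, 687 + 186*z, -10 + -333*z]

noncomputable def WYXX (z : ℂ) : Matrix (Fin 4) (Fin 4) ℂ :=
  !![-105 + -68*z, -46 + 40*z, -66 + 27*z, 28 + 51*z;
    -181 + -128*z, -89 + 59*z, -123 + 37*z, 44 + 89*z;
    -217 + -176*z, -126 + 55*z, -165 + 24*z, 43 + 108*z;
    -57 + 84*z, 78 + 111*z, 68 + 127*z, 64 + 13*z]

noncomputable def WXYX (z : ℂ) : Matrix (Fin 4) (Fin 4) ℂ :=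
  !![-15 + -78*z, -68 + -45*z, -67 + -56*z, -21 + 16*z;
    -204 + -182*z, -133 + 46*z, -164 + 11*z, 35 + 101*z;
    -328 + -392*z, -305 + -1*z, -350 + -72*z, 19 + 177*z;
    -362 + 44*z, 92 + 358*z, 22 + 350*z, 203 + 132*z]

noncomputable def WYYX (z : ℂ) : Matrix (Fin 4) (Fin 4) ℂ :=
  !![21 + -48*z, -46 + -55*z, -40 + -62*z, -30 + -2*z;
    46 + -64*z, -64 + -89*z, -54 + -98*z, -48 + -8*z;
    84 + -50*z, -57 + -114*z, -41 + -118*z, -62 + -24*z;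
    -70 + -77*z, -59 + 5*z, -69 + -9*z, 7 + 37*z]

noncomputable def WXXY (z : ℂ) : Matrix (Fin 4) (Fin 4) ℂ :=
  !![-20 + -85*z, -81 + -60*z, -67 + -55*z, -23 + 24*z;
    -224 + -199*z, -188 + 27*z, -168 + 9*z, 53 + 131*z;
    -360 + -419*z, -399 + -51*z, -346 + -68*z, 43 + 228*z;
    -393 + 51*z, 55 + 428*z, 19 + 350*z, 259 + 154*z]

noncomputable def WYXY (z : ℂ) : Matrix (Fin 4) (Fin 4) ℂ :=
  !![25 + -40*z, -39 + -63*z, -30 + -53*z, -32 + -3*z;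
    50 + -64*z, -64 + -110*z, -48 + -93*z, -57 + -8*z;
    76 + -64*z, -65 + -135*z, -47 + -112*z, -71 + -18*z;
    -70 + -80*z, -76 + -8*z, -66 + -12*z, 9 + 44*z]

noncomputable def WXYY (z : ℂ) : Matrix (Fin 4) (Fin 4) ℂ :=
  !![54 + 30*z, 29 + -25*z, 23 + -20*z, -21 + -26*z;
    92 + -56*z, -57 + -147*z, -45 + -119*z, -76 + -22*z;
    222 + -38*z, -37 + -257*z, -30 + -210*z, -148 + -76*z;
    -113 + -295*z, -293 + -181*z, -239 + -148*z, -44 + 109*z]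

noncomputable def WYYY (z : ℂ) : Matrix (Fin 4) (Fin 4) ℂ :=
  !![42 + 42*z, 42 + 1*z, 35 + 1*z, -9 + -26*z;
    59 + 68*z, 69 + 9*z, 56 + 7*z, -11 + -39*z;
    56 + 88*z, 88 + 32*z, 72 + 25*z, -2 + -42*z;
    42 + -12*z, -12 + -54*z, -10 + -44*z, -30 + -13*z]

noncomputable def WYXXX (z : ℂ) : Matrix (Fin 4) (Fin 4) ℂ :=
  !![784 + 56*z, -39 + -629*z, 103 + -622*z, -390 + -324*z;
    1412 + 206*z, 22 + -1054*z, 277 + -1024*z, -662 + -598*z;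
    1817 + 454*z, 190 + -1216*z, 517 + -1143*z, -775 + -791*z;
    -243 + -1107*z, -921 + -618*z, -970 + -821*z, -320 + 234*z]

theorem mul_XX (z : ℂ) (h : z ^ 2 + z + 1 = 0) : WX z * WX z = WXX z := by
  apply ext16 <;> rw [Matrix.mul_apply, Fin.sum_univ_four] <;>
    simp only [WX, WX, WXX, Matrix.of_apply, Matrix.cons_val]
  · linear_combination (17) * h
  · linear_combination (5) * h
  · linear_combination (9) * h
  · linear_combination (-8) * h
  · linear_combination (-10) * h
  · linear_combination (46) * h
  · linear_combination (49) * h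
  · linear_combination (23) * h
  · linear_combination (18) * h
  · linear_combination (86) * h
  · linear_combination (100) * h
  · linear_combination (26) * h
  · linear_combination (-107) * h
  · linear_combination (80) * h
  · linear_combination (64) * h
  · linear_combination (91) * h

theorem mul_YX (z : ℂ) (h : z ^ 2 + z + 1 = 0) : WY z * WX z = WYX z := by
  apply ext16 <;> rw [Matrix.mul_apply, Fin.sum_univ_four] <;>
    simp only [WY, WX, WYX, Matrix.of_apply, Matrix.cons_val]
  · linear_combination (20) * h
  · linear_combination (1) * h
  · linear_combination (6) * h
  · linear_combination (-10) * h
  · linear_combination (26) * h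
  · linear_combination (-7) * h
  · linear_combination (0) * h
  · linear_combination (-14) * h
  · linear_combination (33) * h
  · linear_combination (-24) * h
  · linear_combination (-18) * h
  · linear_combination (-27) * h
  · linear_combination (0) * h
  · linear_combination (17) * h
  · linear_combination (19) * h
  · linear_combination (7) * h

theorem mul_XY (z : ℂ) (h : z ^ 2 + z + 1 = 0) : WX z * WY z = WXY z := by
  apply ext16 <;> rw [Matrix.mul_apply, Fin.sum_univ_four] <;>
    simp only [WX, WY, WXY, Matrix.of_apply, Matrix.cons_val]
  · linear_combination (6) * h
  · linear_combination (6) * h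
  · linear_combination (6) * h
  · linear_combination (-1) * h
  · linear_combination (-13) * h
  · linear_combination (-16) * h
  · linear_combination (-8) * h
  · linear_combination (3) * h
  · linear_combination (-14) * h
  · linear_combination (-12) * h
  · linear_combination (-4) * h
  · linear_combination (4) * h
  · linear_combination (-65) * h
  · linear_combination (-67) * h
  · linear_combination (-49) * h
  · linear_combination (16) * h

theorem mul_YY (z : ℂ) (h : z ^ 2 + z + 1 = 0) : WY z * WY z = WYY z := by
  apply ext16 <;> rw [Matrix.mul_apply, Fin.sum_univ_four] <;>
    simp only [WY, WY, WYY, Matrix.of_apply, Matrix.cons_val]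
  · linear_combination (8) * h
  · linear_combination (9) * h
  · linear_combination (7) * h
  · linear_combination (-2) * h
  · linear_combination (12) * h
  · linear_combination (15) * h
  · linear_combination (9) * h
  · linear_combination (-4) * h
  · linear_combination (21) * h
  · linear_combination (21) * h
  · linear_combination (15) * h
  · linear_combination (-6) * h
  · linear_combination (-4) * h
  · linear_combination (-4) * h
  · linear_combination (-2) * h
  · linear_combination (1) * h

theorem mul_XXX (z : ℂ) (h : z ^ 2 + z + 1 = 0) : WX z * WXX z = WXXX z := by
  apply ext16 <;> rw [Matrix.mul_apply, Fin.sum_univ_four] <;>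
    simp only [WX, WXX, WXXX, Matrix.of_apply, Matrix.cons_val]
  · linear_combination (-116) * h
  · linear_combination (30) * h
  · linear_combination (7) * h
  · linear_combination (70) * h
  · linear_combination (-264) * h
  · linear_combination (-429) * h
  · linear_combination (-489) * h
  · linear_combination (-85) * h
  · linear_combination (-668) * h
  · linear_combination (-674) * h
  · linear_combination (-816) * h
  · linear_combination (-10) * h
  · linear_combination (-15) * h
  · linear_combination (-1117) * h
  · linear_combination (-1134) * h
  · linear_combination (-536) * h

theorem mul_YXX (z : ℂ) (h : z ^ 2 + z + 1 = 0) : WY z * WXX z = WYXX z := by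
  apply ext16 <;> rw [Matrix.mul_apply, Fin.sum_univ_four] <;>
    simp only [WY, WXX, WYXX, Matrix.of_apply, Matrix.cons_val]
  · linear_combination (-105) * h
  · linear_combination (68) * h
  · linear_combination (48) * h
  · linear_combination (83) * h
  · linear_combination (-83) * h
  · linear_combination (144) * h
  · linear_combination (130) * h
  · linear_combination (109) * h
  · linear_combination (-3) * h
  · linear_combination (333) * h
  · linear_combination (336) * h
  · linear_combination (162) * h
  · linear_combination (-115) * h
  · linear_combination (-147) * h
  · linear_combination (-172) * h
  · linear_combination (-17) * h

theorem mul_XYX (z : ℂ) (h : z ^ 2 + z + 1 = 0) : WX z * WYX z = WXYX z := by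
  apply ext16 <;> rw [Matrix.mul_apply, Fin.sum_univ_four] <;>
    simp only [WX, WYX, WXYX, Matrix.of_apply, Matrix.cons_val]
  · linear_combination (-52) * h
  · linear_combination (-24) * h
  · linear_combination (-33) * h
  · linear_combination (15) * h
  · linear_combination (136) * h
  · linear_combination (5) * h
  · linear_combination (26) * h
  · linear_combination (-57) * h
  · linear_combination (128) * h
  · linear_combination (-46) * h
  · linear_combination (-26) * h
  · linear_combination (-72) * h
  · linear_combination (590) * h
  · linear_combination (127) * h
  · linear_combination (223) * h
  · linear_combination (-222) * h

theorem mul_YYX (z : ℂ) (h : z ^ 2 + z + 1 = 0) : WY z * WYX z = WYYX z := by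
  apply ext16 <;> rw [Matrix.mul_apply, Fin.sum_univ_four] <;>
    simp only [WY, WYX, WYYX, Matrix.of_apply, Matrix.cons_val]
  · linear_combination (-74) * h
  · linear_combination (-28) * h
  · linear_combination (-40) * h
  · linear_combination (24) * h
  · linear_combination (-118) * h
  · linear_combination (-36) * h
  · linear_combination (-54) * h
  · linear_combination (42) * h
  · linear_combination (-186) * h
  · linear_combination (-39) * h
  · linear_combination (-69) * h
  · linear_combination (72) * h
  · linear_combination (38) * h
  · linear_combination (-4) * h
  · linear_combination (2) * h
  · linear_combination (-18) * h

theorem mul_XXY (z : ℂ) (h : z ^ 2 + z + 1 = 0) : WX z * WXY z = WXXY z := by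
  apply ext16 <;> rw [Matrix.mul_apply, Fin.sum_univ_four] <;>
    simp only [WX, WXY, WXXY, Matrix.of_apply, Matrix.cons_val]
  · linear_combination (-39) * h
  · linear_combination (-88) * h
  · linear_combination (-73) * h
  · linear_combination (-16) * h
  · linear_combination (323) * h
  · linear_combination (67) * h
  · linear_combination (84) * h
  · linear_combination (-164) * h
  · linear_combination (472) * h
  · linear_combination (-50) * h
  · linear_combination (2) * h
  · linear_combination (-308) * h
  · linear_combination (917) * h
  · linear_combination (590) * h
  · linear_combination (547) * h
  · linear_combination (-288) * h

theorem mul_YXY (z : ℂ) (h : z ^ 2 + z + 1 = 0) : WY z * WXY z = WYXY z := by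
  apply ext16 <;> rw [Matrix.mul_apply, Fin.sum_univ_four] <;>
    simp only [WY, WXY, WYXY, Matrix.of_apply, Matrix.cons_val]
  · linear_combination (-69) * h
  · linear_combination (-101) * h
  · linear_combination (-86) * h
  · linear_combination (-4) * h
  · linear_combination (-129) * h
  · linear_combination (-127) * h
  · linear_combination (-112) * h
  · linear_combination (20) * h
  · linear_combination (-273) * h
  · linear_combination (-180) * h
  · linear_combination (-165) * h
  · linear_combination (84) * h
  · linear_combination (107) * h
  · linear_combination (8) * h
  · linear_combination (16) * h
  · linear_combination (-61) * h

theorem mul_XYY (z : ℂ) (h : z ^ 2 + z + 1 = 0) : WX z * WYY z = WXYY z := by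
  apply ext16 <;> rw [Matrix.mul_apply, Fin.sum_univ_four] <;>
    simp only [WX, WYY, WXYY, Matrix.of_apply, Matrix.cons_val]
  · linear_combination (11) * h
  · linear_combination (-22) * h
  · linear_combination (-20) * h
  · linear_combination (-17) * h
  · linear_combination (4) * h
  · linear_combination (81) * h
  · linear_combination (62) * h
  · linear_combination (20) * h
  · linear_combination (38) * h
  · linear_combination (98) * h
  · linear_combination (72) * h
  · linear_combination (2) * h
  · linear_combination (-30) * h
  · linear_combination (316) * h
  · linear_combination (265) * h
  · linear_combination (134) * h

theorem mul_YYY (z : ℂ) (h : z ^ 2 + z + 1 = 0) : WY z * WYY z = WYYY z := by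
  apply ext16 <;> rw [Matrix.mul_apply, Fin.sum_univ_four] <;>
    simp only [WY, WYY, WYYY, Matrix.of_apply, Matrix.cons_val]
  · linear_combination (11) * h
  · linear_combination (-35) * h
  · linear_combination (-31) * h
  · linear_combination (-21) * h
  · linear_combination (11) * h
  · linear_combination (-61) * h
  · linear_combination (-53) * h
  · linear_combination (-29) * h
  · linear_combination (6) * h
  · linear_combination (-102) * h
  · linear_combination (-87) * h
  · linear_combination (-42) * h
  · linear_combination (5) * h
  · linear_combination (25) * h
  · linear_combination (19) * h
  · linear_combination (4) * h

theorem mul_YXXX (z : ℂ) (h : z ^ 2 + z + 1 = 0) : WY z * WXXX z = WYXXX z := by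
  apply ext16 <;> rw [Matrix.mul_apply, Fin.sum_univ_four] <;>
    simp only [WY, WXXX, WYXXX, Matrix.of_apply, Matrix.cons_val]
  · linear_combination (42) * h
  · linear_combination (-1032) * h
  · linear_combination (-1029) * h
  · linear_combination (-510) * h
  · linear_combination (-556) * h
  · linear_combination (-1616) * h
  · linear_combination (-1725) * h
  · linear_combination (-502) * h
  · linear_combination (-2151) * h
  · linear_combination (-2934) * h
  · linear_combination (-3339) * h
  · linear_combination (-369) * h
  · linear_combination (1486) * h
  · linear_combination (821) * h
  · linear_combination (1095) * h
  · linear_combination (-318) * h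

theorem comb (z : ℂ) (h : z ^ 2 + z + 1 = 0) :
    (920263793677787 + 79843159422817*z : ℂ) • W1 z + (277646610907231 + -72153080078717*z : ℂ) • WX z + (-334984864754955 + -1191620626161011*z : ℂ) • WY z + (-137506320827480 + 958034503679123*z : ℂ) • WXX z + (356881678069409 + 267416449148776*z : ℂ) • WYX z + (-634815236403469 + 52876049904988*z : ℂ) • WXY z + (-332794057969569 + 404178571586469*z : ℂ) • WYY z + (-37753496880138 + 75525413612683*z : ℂ) • WXXX z + (927786510708549 + 635244290242244*z : ℂ) • WYXX z + (28442868911473 + 104060354329491*z : ℂ) • WXYX z + (-17732395180170 + 104838836864809*z : ℂ) • WYYX z + (23571901988259 + 40662071298902*z : ℂ) • WXXY z + (-12044694338440 + 117688306291493*z : ℂ) • WYXY z + (7588637105504 + 183893048529965*z : ℂ) • WXYY z + (-111311085035781 + 65257093039113*z : ℂ) • WYYY z + (74018692521656 + 99119826980164*z : ℂ) • WYXXX z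
    = Matrix.single 2 1 (847884981786846 : ℂ) := by
  apply ext16 <;>
    simp only [W1, WX, WY, WXX, WYX, WXY, WYY, WXXX, WYXX, WXYX, WYYX, WXXY, WYXY, WXYY, WYYY, WYXXX, Matrix.single_apply, reduceIte, Fin.reduceEq, and_true, and_false, and_self, Matrix.add_apply, Matrix.smul_apply, smul_eq_mul, Matrix.of_apply, Matrix.cons_val]
  · linear_combination (-33097774028428952) * h
  · linear_combination (-55157213505275506) * h
  · linear_combination (-59053491657096338) * h
  · linear_combination (-9305920362989404) * h
  · linear_combination (-85912724021861243) * h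
  · linear_combination (-113883831688909617) * h
  · linear_combination (-124145874418510628) * h
  · linear_combination (-10788001760029396) * h
  · linear_combination (-93539179087855775) * h
  · linear_combination (-167663872059233334) * h
  · linear_combination (-172623795713276440) * h
  · linear_combination (-30470048814376184) * h
  · linear_combination (-147189493026849144) * h
  · linear_combination (-21588224163790692) * h
  · linear_combination (-37843211985927317) * h
  · linear_combination (68620234248896582) * h

theorem cols (z : ℂ) (h : z ^ 2 + z + 1 = 0) (V : Submodule ℂ (Fin 4 → ℂ))
    (h0 : (fun i => W1 z i 2) ∈ V)
    (h1 : (fun i => WY z i 2) ∈ V)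
    (h2 : (fun i => WYX z i 2) ∈ V)
    (h3 : (fun i => WYY z i 2) ∈ V)
    : V = ⊤ := by
  have e0 : Pi.single 0 (1 : ℂ) ∈ V := by
    have hm : (-2*z : ℂ) • (fun i => W1 z i 2) + (1 + 1*z : ℂ) • (fun i => WY z i 2) + (-1 : ℂ) • (fun i => WYX z i 2) + (-1 + -2*z : ℂ) • (fun i => WYY z i 2) ∈ V :=
      V.add_mem (V.add_mem (V.add_mem (V.smul_mem _ h0) (V.smul_mem _ h1)) (V.smul_mem _ h2)) (V.smul_mem _ h3)
    refine mem_of_smul V (2) (by norm_num) ?_ hm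
    apply ext4 <;>
      simp only [W1, WY, WYX, WYY, Pi.add_apply, Pi.smul_apply, smul_eq_mul, Matrix.of_apply, Matrix.cons_val, Pi.single_apply, reduceIte, Fin.reduceEq]
    · linear_combination (-17) * h
    · linear_combination (-23) * h
    · linear_combination (-23) * h
    · linear_combination (-11) * h
  have e1 : Pi.single 1 (1 : ℂ) ∈ V := by
    have hm : (4 + 14*z : ℂ) • (fun i => W1 z i 2) + (-6 + -21*z : ℂ) • (fun i => WY z i 2) + (3 + 3*z : ℂ) • (fun i => WYX z i 2) + (-7 + 1*z : ℂ) • (fun i => WYY z i 2) ∈ V :=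
      V.add_mem (V.add_mem (V.add_mem (V.smul_mem _ h0) (V.smul_mem _ h1)) (V.smul_mem _ h2)) (V.smul_mem _ h3)
    refine mem_of_smul V (12) (by norm_num) ?_ hm
    apply ext4 <;>
      simp only [W1, WY, WYX, WYY, Pi.add_apply, Pi.smul_apply, smul_eq_mul, Matrix.of_apply, Matrix.cons_val, Pi.single_apply, reduceIte, Fin.reduceEq]
    · linear_combination (41) * h
    · linear_combination (53) * h
    · linear_combination (109) * h
    · linear_combination (-54) * h
  have e2 : Pi.single 2 (1 : ℂ) ∈ V := by
    have hm : (1 : ℂ) • (fun i => W1 z i 2) + (0 : ℂ) • (fun i => WY z i 2) + (0 : ℂ) • (fun i => WYX z i 2) + (0 : ℂ) • (fun i => WYY z i 2) ∈ V :=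
      V.add_mem (V.add_mem (V.add_mem (V.smul_mem _ h0) (V.smul_mem _ h1)) (V.smul_mem _ h2)) (V.smul_mem _ h3)
    refine mem_of_smul V (1) (by norm_num) ?_ hm
    apply ext4 <;>
      simp only [W1, WY, WYX, WYY, Pi.add_apply, Pi.smul_apply, smul_eq_mul, Matrix.of_apply, Matrix.cons_val, Pi.single_apply, reduceIte, Fin.reduceEq]
    · linear_combination (0) * h
    · linear_combination (0) * h
    · linear_combination (0) * h
    · linear_combination (0) * h
  have e3 : Pi.single 3 (1 : ℂ) ∈ V := by
    have hm : (-6 + -24*z : ℂ) • (fun i => W1 z i 2) + (-23 + -4*z : ℂ) • (fun i => WY z i 2) + (6 + 3*z : ℂ) • (fun i => WYX z i 2) + (2 + 13*z : ℂ) • (fun i => WYY z i 2) ∈ V :=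
      V.add_mem (V.add_mem (V.add_mem (V.smul_mem _ h0) (V.smul_mem _ h1)) (V.smul_mem _ h2)) (V.smul_mem _ h3)
    refine mem_of_smul V (12) (by norm_num) ?_ hm
    apply ext4 <;>
      simp only [W1, WY, WYX, WYY, Pi.add_apply, Pi.smul_apply, smul_eq_mul, Matrix.of_apply, Matrix.cons_val, Pi.single_apply, reduceIte, Fin.reduceEq]
    · linear_combination (120) * h
    · linear_combination (168) * h
    · linear_combination (178) * h
    · linear_combination (35) * h
  exact top_of V e0 e1 e2 e3

theorem rows (z : ℂ) (h : z ^ 2 + z + 1 = 0) (v : Fin 4 → ℂ)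
    (h0 : (W1 z).mulVec v 1 = 0)
    (h1 : (WX z).mulVec v 1 = 0)
    (h2 : (WY z).mulVec v 1 = 0)
    (h3 : (WYX z).mulVec v 1 = 0)
    : v = 0 := by
  simp only [Matrix.mulVec, dotProduct, Fin.sum_univ_four, W1, WX, WY, WYX, Matrix.of_apply, Matrix.cons_val] at h0 h1 h2 h3
  apply ext4
  · refine zero_of_mul (6) (by norm_num) ?_
    linear_combination (2 + 13*z) * h0 + (6) * h1 + (9 + 3*z) * h2 + (1 + -1*z) * h3 - ((-28) * v 0 + (-13) * v 1 + (-10) * v 2 + (12) * v 3) * h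
  · refine zero_of_mul (1) (by norm_num) ?_
    linear_combination (1) * h0 + (0) * h1 + (0) * h2 + (0) * h3 - ((0) * v 0 + (0) * v 1 + (0) * v 2 + (0) * v 3) * h
  · refine zero_of_mul (6) (by norm_num) ?_
    linear_combination (26 + 13*z) * h0 + (-24 + -18*z) * h1 + (-9 + -21*z) * h2 + (-5 + -1*z) * h3 - ((74) * v 0 + (-13) * v 1 + (-40) * v 2 + (-48) * v 3) * h
  · refine zero_of_mul (6) (by norm_num) ?_
    linear_combination (4 + -31*z) * h0 + (30*z) * h1 + (-21 + -3*z) * h2 + (5 + 7*z) * h3 - ((70) * v 0 + (157) * v 1 + (142) * v 2 + (-6) * v 3) * h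

theorem W1_eq : W1 ζ = 1 := by
  ext i j; fin_cases i <;> fin_cases j <;> simp [W1]

theorem WX_eq : matX = WX ζ := by
  have h := zeta_eq
  have h2 : ζ ^ 2 = -1 - ζ := by linear_combination h
  apply ext16 <;> simp only [matX, WX, Matrix.of_apply, Matrix.cons_val, h2] <;> ring

theorem WY_eq : matY = WY ζ := by
  have h := zeta_eq
  have h2 : ζ ^ 2 = -1 - ζ := by linear_combination h
  apply ext16 <;> simp only [matY, WY, Matrix.of_apply, Matrix.cons_val, h2] <;> ring

theorem bot_or_top (V : Submodule ℂ (Fin 4 → ℂ))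
    (iX : Stab V (WX ζ)) (iY : Stab V (WY ζ)) : V = ⊥ ∨ V = ⊤ := by
  have i1 : Stab V (W1 ζ) := by rw [W1_eq]; exact stab_one V
  have iXX : Stab V (WXX ζ) := by rw [← mul_XX ζ zeta_eq]; exact stab_mul V iX iX
  have iYX : Stab V (WYX ζ) := by rw [← mul_YX ζ zeta_eq]; exact stab_mul V iY iX
  have iXY : Stab V (WXY ζ) := by rw [← mul_XY ζ zeta_eq]; exact stab_mul V iX iY
  have iYY : Stab V (WYY ζ) := by rw [← mul_YY ζ zeta_eq]; exact stab_mul V iY iY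
  have iXXX : Stab V (WXXX ζ) := by rw [← mul_XXX ζ zeta_eq]; exact stab_mul V iX iXX
  have iYXX : Stab V (WYXX ζ) := by rw [← mul_YXX ζ zeta_eq]; exact stab_mul V iY iXX
  have iXYX : Stab V (WXYX ζ) := by rw [← mul_XYX ζ zeta_eq]; exact stab_mul V iX iYX
  have iYYX : Stab V (WYYX ζ) := by rw [← mul_YYX ζ zeta_eq]; exact stab_mul V iY iYX
  have iXXY : Stab V (WXXY ζ) := by rw [← mul_XXY ζ zeta_eq]; exact stab_mul V iX iXY
  have iYXY : Stab V (WYXY ζ) := by rw [← mul_YXY ζ zeta_eq]; exact stab_mul V iY iXY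
  have iXYY : Stab V (WXYY ζ) := by rw [← mul_XYY ζ zeta_eq]; exact stab_mul V iX iYY
  have iYYY : Stab V (WYYY ζ) := by rw [← mul_YYY ζ zeta_eq]; exact stab_mul V iY iYY
  have iYXXX : Stab V (WYXXX ζ) := by rw [← mul_YXXX ζ zeta_eq]; exact stab_mul V iY iXXX
  have iE : Stab V (Matrix.single 2 1 (847884981786846 : ℂ)) := by
    rw [← comb ζ zeta_eq]
    exact stab_add V (stab_add V (stab_add V (stab_add V (stab_add V (stab_add V (stab_add V (stab_add V (stab_add V (stab_add V (stab_add V (stab_add V (stab_add V (stab_add V (stab_add V (stab_smul V _ i1) (stab_smul V _ iX)) (stab_smul V _ iY)) (stab_smul V _ iXX)) (stab_smul V _ iYX)) (stab_smul V _ iXY)) (stab_smul V _ iYY)) (stab_smul V _ iXXX)) (stab_smul V _ iYXX)) (stab_smul V _ iXYX)) (stab_smul V _ iYYX)) (stab_smul V _ iXXY)) (stab_smul V _ iYXY)) (stab_smul V _ iXYY)) (stab_smul V _ iYYY)) (stab_smul V _ iYXXX)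
  by_cases hV : ∃ v ∈ V, v 1 ≠ 0
  · right
    obtain ⟨v, hv, hv0⟩ := hV
    have he : (Pi.single 2 (1 : ℂ) : Fin 4 → ℂ) ∈ V := by
      refine mem_of_smul V (847884981786846 * v 1) (mul_ne_zero (by norm_num) hv0) ?_ (iE v hv)
      rw [Matrix.single_mulVec]
      apply ext4 <;> simp
    have hc : ∀ {M : Matrix (Fin 4) (Fin 4) ℂ}, Stab V M → (fun i => M i 2) ∈ V := by
      intro M hM
      have := hM _ he
      rw [Matrix.mulVec_single_one] at this
      exact this
    exact cols ζ zeta_eq V (hc i1) (hc iY) (hc iYX) (hc iYY)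
  · left
    push Not at hV
    rw [eq_bot_iff]
    intro v hv
    have hr : ∀ {M : Matrix (Fin 4) (Fin 4) ℂ}, Stab V M → M.mulVec v 1 = 0 :=
      fun hM => hV _ (hM _ hv)
    exact (Submodule.mem_bot ℂ).mpr (rows ζ zeta_eq v (hr i1) (hr iX) (hr iY) (hr iYX))

/-- The matrices `X` and `Y` have no common invariant subspace of `ℂ⁴` of dimension `1`
or `2`. -/
theorem no_common_invariant_subspace_dim_one_or_two
    (V : Submodule ℂ (Fin 4 → ℂ))
    (hXV : ∀ v ∈ V, matX.mulVec v ∈ V)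
    (hYV : ∀ v ∈ V, matY.mulVec v ∈ V) :
    Module.finrank ℂ V ≠ 1 ∧ Module.finrank ℂ V ≠ 2 := by
  rw [WX_eq] at hXV
  rw [WY_eq] at hYV
  rcases bot_or_top V hXV hYV with h | h <;> subst h <;> simp
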